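/- Qualitative reachability depends only on null sets of the initial distribution: let (S, Σ, κ) be a stochastic transition system and B ∈ Σ. Then for every initial distribution μ: (i) P_μ(F B) = 0 if and only if μ(B̃) = 1; and (ii) if μ and μ' are initial distributions that are qualitatively equivalent (i.e., for every C ∈ Σ, μ(C) > 0 iff μ'(C) > 0), then P_μ(F B) = 0 iff P_{μ'}(F B) = 0, and P_μ(F B) = 1 iff P_{μ'}(F B) = 1. -/

import Mathlib

open MeasureTheory ProbabilityTheory Filter Set Topology

/-- Prepend one state to an infinite run. -/
def prep {S : Type*} (s : S) (ρ : ℕ → S) : ℕ → S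
  | 0 => s
  | n + 1 => ρ n

/-- Prepend a finite word to an infinite run. -/
def prepList {S : Type*} (l : List S) (ρ : ℕ → S) : ℕ → S := fun n =>
  if h : n < l.length then l.get ⟨n, h⟩ else ρ (n - l.length)

/-- `E` is a tail event: membership is not affected by changing a finite prefix. -/
def IsTailEvent {S : Type*} (E : Set (ℕ → S)) : Prop :=
  ∀ (l : List S) (ρ : ℕ → S), ρ ∈ E ↔ prepList l ρ ∈ E

/-- Cylinder `Cyl A n = {ρ | ρ k ∈ A k for all k < n}` (built from `A 0, …, A (n-1)`). -/
def Cyl {S : Type*} (A : ℕ → Set S) (n : ℕ) : Set (ℕ → S) := {ρ | ∀ k < n, ρ k ∈ A k}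

/-- Event `F B`: eventually reach `B`. -/
def FEv {S : Type*} (B : Set S) : Set (ℕ → S) := {ρ | ∃ n, ρ n ∈ B}

/-- Event `F^{≤ m} B`: reach `B` within `m` steps. -/
def FleEv {S : Type*} (m : ℕ) (B : Set S) : Set (ℕ → S) := {ρ | ∃ n ≤ m, ρ n ∈ B}

/-- Event `G B`: always in `B`. -/
def GEv {S : Type*} (B : Set S) : Set (ℕ → S) := {ρ | ∀ n, ρ n ∈ B}

/-- Event `GF B`: visit `B` infinitely often. -/
def GFEv {S : Type*} (B : Set S) : Set (ℕ → S) := {ρ | ∀ i, ∃ j ≥ i, ρ j ∈ B}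

/-- Event `FG B`: eventually always in `B`. -/
def FGEv {S : Type*} (B : Set S) : Set (ℕ → S) := {ρ | ∃ i, ∀ j ≥ i, ρ j ∈ B}

/-- Event `GF φ_𝒜`: the pattern `A 0, …, A n` occurs at infinitely many positions. -/
def GFPat {S : Type*} (A : ℕ → Set S) (n : ℕ) : Set (ℕ → S) :=
  {ρ | ∀ i, ∃ j ≥ i, ∀ k ≤ n, ρ (j + k) ∈ A k}

/-- Event `A U B`. -/
def UntilEv {S : Type*} (A B : Set S) : Set (ℕ → S) :=
  {ρ | ∃ n, ρ n ∈ B ∧ ∀ k < n, ρ k ∈ A}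

/-- Event `A U^{≤ m} B`. -/
def UntilLeEv {S : Type*} (m : ℕ) (A B : Set S) : Set (ℕ → S) :=
  {ρ | ∃ n ≤ m, ρ n ∈ B ∧ ∀ k < n, ρ k ∈ A}

/-- The filtration `F n`: σ-algebra generated by the cylinders of length `n`,
i.e., by the first `n` coordinates. -/
def cylFiltration (S : Type*) [MeasurableSpace S] (n : ℕ) : MeasurableSpace (ℕ → S) :=
  MeasurableSpace.comap (fun ρ (i : Fin n) => ρ i) inferInstance

/-- `P` is the family of path measures of the STS `(S, Σ, κ)` given by the
Ionescu–Tulcea construction: for every initial probability distribution `μ`,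
`P μ` is a probability measure on runs, and `P` satisfies the Markov property
(`s₀ ∼ μ`, and the rest of the run follows the chain started in `κ s₀`),
which uniquely characterizes the Ionescu–Tulcea path measures. -/
def IsPathMeasure {S : Type*} [MeasurableSpace S] (κ : Kernel S S)
    (P : Measure S → Measure (ℕ → S)) : Prop :=
  (∀ μ : Measure S, IsProbabilityMeasure μ → IsProbabilityMeasure (P μ)) ∧
  (∀ μ : Measure S, IsProbabilityMeasure μ →
    P μ = μ.bind fun s => (P (κ s)).map (prep s))

/-- `B̃`: the set of states from which `B` is reached with probability zero. -/
def Btilde {S : Type*} [MeasurableSpace S] (P : Measure S → Measure (ℕ → S)) (B : Set S) :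
    Set S := {s | P (Measure.dirac s) (FEv B) = 0}

/-- The STS with path measures `P` is decisive w.r.t. `B`. -/
def Decisive {S : Type*} [MeasurableSpace S] (P : Measure S → Measure (ℕ → S)) (B : Set S) :
    Prop := ∀ μ : Measure S, IsProbabilityMeasure μ → P μ (FEv B ∪ FEv (Btilde P B)) = 1

/-- `ν_{A₀,…,Aₙ}`: the distribution of the `n`-th state under `P ν` conditioned on
the cylinder `Cyl A (n+1)`. -/
noncomputable def condDist {S : Type*} [MeasurableSpace S]
    (P : Measure S → Measure (ℕ → S)) (ν : Measure S) (A : ℕ → Set S) (n : ℕ) : Measure S :=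
  (ProbabilityTheory.cond (P ν) (Cyl A (n + 1))).map fun ρ => ρ n

lemma measurable_prep {S : Type*} [MeasurableSpace S] (s : S) : Measurable (prep s) := by
  refine measurable_pi_lambda _ fun n => ?_
  cases n with
  | zero => exact measurable_const
  | succ n => exact measurable_pi_apply n

lemma measurableSet_FEv {S : Type*} [MeasurableSpace S] {B : Set S} (hB : MeasurableSet B) :
    MeasurableSet (FEv B) := by
  have h : FEv B = ⋃ n, (fun ρ : ℕ → S => ρ n) ⁻¹' B := by
    ext ρ
    simp [FEv]
  rw [h]
  exact MeasurableSet.iUnion fun n => measurable_pi_apply n hB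

lemma dirac_bind_of_aemeasurable {α β : Type*} [MeasurableSpace α] [MeasurableSpace β]
    {f : α → Measure β} {a : α} (hf : AEMeasurable f (Measure.dirac a)) :
    (Measure.dirac a).bind f = f a := by
  have ha : f a = hf.mk f a := by
    by_contra hne
    obtain ⟨t, hst, ht, ht0⟩ := exists_measurable_superset_of_null (ae_iff.1 hf.ae_eq_mk)
    rw [Measure.dirac_apply' a ht, Set.indicator_of_mem (hst hne)] at ht0
    exact one_ne_zero ht0
  rw [ha, ← Measure.dirac_bind hf.measurable_mk a]
  exact Measure.bind_congr_right hf.ae_eq_mk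

lemma aemeasurable_of_bind_ne_zero {α β : Type*} [MeasurableSpace α] [MeasurableSpace β]
    {μ : Measure α} {f : α → Measure β} (h : μ.bind f ≠ 0) : AEMeasurable f μ := by
  by_contra hf
  exact h (by rw [Measure.bind, Measure.map_of_not_aemeasurable hf, Measure.join_zero])

namespace IsPathMeasure

variable {S : Type*} [MeasurableSpace S] {κ : Kernel S S} {P : Measure S → Measure (ℕ → S)}

lemma aemeasurable_step (hP : IsPathMeasure κ P) (μ : Measure S) [hμ : IsProbabilityMeasure μ] :
    AEMeasurable (fun s => (P (κ s)).map (prep s)) μ := by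
  have := hP.1 μ hμ
  refine aemeasurable_of_bind_ne_zero ?_
  rw [← hP.2 μ hμ]
  exact IsProbabilityMeasure.ne_zero _

lemma apply_dirac (hP : IsPathMeasure κ P) (s : S) :
    P (Measure.dirac s) = (P (κ s)).map (prep s) := by
  rw [hP.2 _ inferInstance]
  exact dirac_bind_of_aemeasurable (hP.aemeasurable_step (Measure.dirac s))

lemma aemeasurable_dirac (hP : IsPathMeasure κ P) (μ : Measure S) [IsProbabilityMeasure μ] :
    AEMeasurable (fun s => P (Measure.dirac s)) μ := by
  simpa only [hP.apply_dirac] using hP.aemeasurable_step μ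

lemma aemeasurable_dirac_apply (hP : IsPathMeasure κ P) (μ : Measure S) [IsProbabilityMeasure μ]
    {E : Set (ℕ → S)} (hE : MeasurableSet E) :
    AEMeasurable (fun s => P (Measure.dirac s) E) μ :=
  (Measure.measurable_coe hE).comp_aemeasurable (hP.aemeasurable_dirac μ)

/-- The path measure is the mixture of the path measures started in Dirac distributions. -/
lemma apply_eq_lintegral (hP : IsPathMeasure κ P) (μ : Measure S) [hμ : IsProbabilityMeasure μ]
    {E : Set (ℕ → S)} (hE : MeasurableSet E) :
    P μ E = ∫⁻ s, P (Measure.dirac s) E ∂μ := by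
  have h : P μ = μ.bind fun s => P (Measure.dirac s) := by
    simp only [hP.apply_dirac]
    exact hP.2 μ hμ
  rw [h, Measure.bind_apply hE (hP.aemeasurable_dirac μ)]

lemma apply_eq_zero_iff (hP : IsPathMeasure κ P) (μ : Measure S) [IsProbabilityMeasure μ]
    {E : Set (ℕ → S)} (hE : MeasurableSet E) :
    P μ E = 0 ↔ ∀ᵐ s ∂μ, P (Measure.dirac s) E = 0 := by
  rw [hP.apply_eq_lintegral μ hE, lintegral_eq_zero_iff' (hP.aemeasurable_dirac_apply μ hE)]
  rfl

lemma nullMeasurableSet_Btilde (hP : IsPathMeasure κ P) (μ : Measure S) [IsProbabilityMeasure μ]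
    {B : Set S} (hB : MeasurableSet B) : NullMeasurableSet (Btilde P B) μ :=
  (hP.aemeasurable_dirac_apply μ (measurableSet_FEv hB)).nullMeasurableSet_preimage
    (measurableSet_singleton 0)

lemma apply_eq_zero_of_absolutelyContinuous (hP : IsPathMeasure κ P) {μ ν : Measure S}
    [IsProbabilityMeasure μ] [IsProbabilityMeasure ν] (h : μ ≪ ν)
    {E : Set (ℕ → S)} (hE : MeasurableSet E) (h0 : P ν E = 0) : P μ E = 0 :=
  (hP.apply_eq_zero_iff μ hE).2 (h.ae_le ((hP.apply_eq_zero_iff ν hE).1 h0))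

end IsPathMeasure

/-- **Qualitative reachability depends only on null sets of the initial distribution.**
(i) `P_μ(F B) = 0` iff `μ(B̃) = 1`; (ii) if `μ` and `μ'` are qualitatively equivalent
(they have the same measurable sets of positive measure), then `P_μ(F B) = 0` iff
`P_{μ'}(F B) = 0`, and `P_μ(F B) = 1` iff `P_{μ'}(F B) = 1`. -/
theorem qualitative_reachability_null_sets
    {S : Type*} [MeasurableSpace S] (κ : Kernel S S) [IsMarkovKernel κ]
    (P : Measure S → Measure (ℕ → S)) (hP : IsPathMeasure κ P)
    (B : Set S) (hB : MeasurableSet B) :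
    (∀ μ : Measure S, IsProbabilityMeasure μ →
      (P μ (FEv B) = 0 ↔ μ (Btilde P B) = 1)) ∧
    (∀ μ μ' : Measure S, IsProbabilityMeasure μ → IsProbabilityMeasure μ' →
      (∀ C : Set S, MeasurableSet C → (0 < μ C ↔ 0 < μ' C)) →
      ((P μ (FEv B) = 0 ↔ P μ' (FEv B) = 0) ∧
       (P μ (FEv B) = 1 ↔ P μ' (FEv B) = 1))) := by
  have hF := measurableSet_FEv hB
  refine ⟨fun μ hμ => ?_, fun μ μ' hμ hμ' h => ?_⟩
  · rw [hP.apply_eq_zero_iff μ hF, ← prob_compl_eq_zero_iff₀ (hP.nullMeasurableSet_Btilde μ hB)]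
    rfl
  · have hac : μ ≪ μ' := Measure.AbsolutelyContinuous.mk fun C hC h0 => by
      by_contra hne
      exact ((h C hC).1 (pos_iff_ne_zero.2 hne)).ne' h0
    have hac' : μ' ≪ μ := Measure.AbsolutelyContinuous.mk fun C hC h0 => by
      by_contra hne
      exact ((h C hC).2 (pos_iff_ne_zero.2 hne)).ne' h0
    have key : ∀ E : Set (ℕ → S), MeasurableSet E → (P μ E = 0 ↔ P μ' E = 0) := fun E hE =>
      ⟨hP.apply_eq_zero_of_absolutelyContinuous hac' hE,
        hP.apply_eq_zero_of_absolutelyContinuous hac hE⟩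
    have := hP.1 μ hμ
    have := hP.1 μ' hμ'
    refine ⟨key _ hF, ?_⟩
    rw [← prob_compl_eq_zero_iff hF, ← prob_compl_eq_zero_iff hF]
    exact key _ hF.compl
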